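/- Let R be a two-dimensional local complete intersection ring, x ∈ R a regular element, X = R/(x), and C = R/Ann_R(X). Then Tor_1^R(X,C) ≠ 0, Tor_i^R(X,C) = 0 for all i ≥ 2, cx_R(X,C) = 0, depth_R(X ⊗_R C) = 1 = cx_R(X,C) + 1, and depth_R(X) + depth_R(C) ≥ depth_R(R) + cx_R(X,C). In particular, the conclusion 'depth inequality implies Tor-independence' fails when λ(Tor_i^R(M,N)) < ∞ is only assumed for i ≫ 0. -/

import Mathlib

open CategoryTheory

noncomputable section

universe u

variable (R : Type u) [CommRing R]

/-- The `i`-th Ext module of two `R`-modules. -/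
abbrev ExtMod (i : ℕ) (M N : ModuleCat.{u} R) : ModuleCat.{u} R :=
  ((Ext R (ModuleCat.{u} R) i).obj (Opposite.op M)).obj N

/-- The `i`-th Tor module of two `R`-modules. -/
abbrev TorMod (i : ℕ) (M N : ModuleCat.{u} R) : ModuleCat.{u} R :=
  ((Tor' (ModuleCat.{u} R) i).obj M).obj N

/-- `D^⊥`. -/
def perpSet (D : Set (ModuleCat.{u} R)) : Set (ModuleCat.{u} R) :=
  {Y | ∀ X ∈ D, ∀ i : ℕ, 0 < i → Subsingleton (ExtMod R i X Y)}

/-- `E^⊤`. -/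
def topSet (E : Set (ModuleCat.{u} R)) : Set (ModuleCat.{u} R) :=
  {X | ∀ Y ∈ E, ∀ i : ℕ, 0 < i → Subsingleton (ExtMod R i X Y)}

/-- depth via maximal lengths of regular sequences in the maximal ideal. -/
def depth [IsLocalRing R] (M : ModuleCat.{u} R) : ℕ :=
  sSup {n | ∃ rs : List R, rs.length = n ∧ (∀ r ∈ rs, r ∈ IsLocalRing.maximalIdeal R) ∧
    RingTheory.Sequence.IsRegular M rs}

/-- `pd_R M ≤ n` via free syzygies. -/
def ProjDimLE : ℕ → ModuleCat.{u} R → Prop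
  | 0, M => Projective M
  | n+1, M => ∃ (K F : ModuleCat.{u} R) (f : K ⟶ F) (g : F ⟶ M) (w : f ≫ g = 0),
      Module.Free R F ∧ (ShortComplex.mk f g w).ShortExact ∧ ProjDimLE n K

/-- Projective dimension, in `ℕ∞`. -/
def projDim (M : ModuleCat.{u} R) : ℕ∞ :=
  sInf {d : ℕ∞ | ∃ n : ℕ, d = n ∧ ProjDimLE R n M}

/-- Totally reflexive modules. -/
def TotallyReflexive (M : ModuleCat.{u} R) : Prop :=
  Function.Bijective (Module.Dual.eval R M) ∧
  (∀ i : ℕ, 0 < i → Subsingleton (ExtMod R i M (ModuleCat.of R R))) ∧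
  (∀ i : ℕ, 0 < i → Subsingleton (ExtMod R i (ModuleCat.of R (Module.Dual R M)) (ModuleCat.of R R)))

/-- `G-dim_R M ≤ n` via syzygies. -/
def GdimLE : ℕ → ModuleCat.{u} R → Prop
  | 0, M => TotallyReflexive R M
  | n+1, M => ∃ (K F : ModuleCat.{u} R) (f : K ⟶ F) (g : F ⟶ M) (w : f ≫ g = 0),
      Module.Free R F ∧ (ShortComplex.mk f g w).ShortExact ∧ GdimLE n K

/-- Gorenstein dimension, in `ℕ∞`. -/
def Gdim (M : ModuleCat.{u} R) : ℕ∞ :=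
  sInf {d : ℕ∞ | ∃ n : ℕ, d = n ∧ GdimLE R n M}

/-- `M` is an `n`-th syzygy module. -/
def IsNthSyzygy : ℕ → ModuleCat.{u} R → Prop
  | 0, _ => True
  | n+1, M => ∃ (F C : ModuleCat.{u} R) (f : M ⟶ F) (g : F ⟶ C) (w : f ≫ g = 0),
      Module.Free R F ∧ (ShortComplex.mk f g w).ShortExact ∧ IsNthSyzygy n C

/-- `syz_R M`: the largest `t ≤ depth R` such that `M` is a `t`-th syzygy. -/
def syz [IsLocalRing R] (M : ModuleCat.{u} R) : ℕ :=
  sSup {t | t ≤ depth R (ModuleCat.of R R) ∧ IsNthSyzygy R t M}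

/-- Complexity of a sequence of natural numbers. -/
def seqComplexity (b : ℕ → ℕ) : ℕ :=
  sInf {r : ℕ | ∃ α : ℝ, ∀ᶠ n in Filter.atTop, (b n : ℝ) ≤ α * (n : ℝ) ^ ((r : ℝ) - 1)}

/-- Minimal number of generators. -/
def numGen (M : ModuleCat.{u} R) : ℕ :=
  sInf {n | ∃ s : Finset M, s.card = n ∧ Submodule.span R (s : Set M) = ⊤}

/-- Complexity of a pair of modules. -/
def cx (M N : ModuleCat.{u} R) : ℕ :=
  seqComplexity (fun i => numGen R (ExtMod R i M N))

/-- Regular local ring: Noetherian local, maximal ideal generated by a regular sequence. -/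
def IsRegularLocal (Q : Type u) [CommRing Q] : Prop :=
  IsLocalRing Q ∧ IsNoetherianRing Q ∧
  ∃ rs : List Q, RingTheory.Sequence.IsRegular Q rs ∧ (Ideal.span {x | x ∈ rs}).IsMaximal

/-- Local complete intersection ring: the completion is a regular local ring
modulo a regular sequence. -/
def IsCompleteIntersectionLocal (R : Type u) [CommRing R] [IsLocalRing R] : Prop :=
  ∃ (Q : CommRingCat.{u})
    (φ : ↥Q →+* AdicCompletion (IsLocalRing.maximalIdeal R) R),
    IsRegularLocal ↥Q ∧ Function.Surjective φ ∧
    ∃ rs : List ↥Q, RingTheory.Sequence.IsRegular (↥Q) rs ∧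
      RingHom.ker φ = Ideal.span {x | x ∈ rs}

/-- Gorenstein local ring: `R` has finite injective dimension over itself,
expressed via eventual vanishing of `Ext^i(-, R)`. -/
def IsGorensteinLocal (R : Type u) [CommRing R] : Prop :=
  IsLocalRing R ∧ IsNoetherianRing R ∧
  ∃ n : ℕ, ∀ (M : ModuleCat.{u} R) (i : ℕ), n < i → Subsingleton (ExtMod R i M (ModuleCat.of R R))


namespace CategoryTheory.ShortComplex.ShortExact

open Limits HomologicalComplex

variable {C : Type*} [Category* C] [Abelian C] {S : ShortComplex C}

variable (S) in
/-- The chain complex with `S.X₁` in degree one, `S.X₂` in degree zero, and zero elsewhere. -/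
abbrev twoTermComplex : ChainComplex C ℕ :=
  double S.f (show (ComplexShape.down ℕ).Rel 1 0 from rfl)

variable (S) in
lemma isZero_twoTermComplex_X (n : ℕ) : IsZero ((twoTermComplex S).X (n + 2)) :=
  isZero_double_X S.f _ (n + 2) (by simp) (by simp)

variable (S) in
lemma twoTermComplex_d_hom :
    (twoTermComplex S).d 1 0 ≫ (doubleXIso₁ S.f _ one_ne_zero).hom =
      (doubleXIso₀ S.f _).hom ≫ S.f := by
  simp [double_d _ _ one_ne_zero]

variable (S) in
lemma twoTermComplex_d_hom_g :
    (twoTermComplex S).d 1 0 ≫ (doubleXIso₁ S.f _ one_ne_zero).hom ≫ S.g = 0 := by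
  rw [← Category.assoc, twoTermComplex_d_hom, Category.assoc, S.zero, comp_zero]

lemma twoTermComplex_exactAt_succ (hS : S.ShortExact) (n : ℕ) :
    (twoTermComplex S).ExactAt (n + 1) := by
  cases n with
  | zero =>
    rw [exactAt_iff' _ 2 1 0 (by simp) (by simp),
      ShortComplex.exact_iff_mono _ ((isZero_twoTermComplex_X S 0).eq_of_src _ _)]
    have := hS.mono_f
    dsimp [sc', shortComplexFunctor']
    rw [double_d _ _ one_ne_zero]
    infer_instance
  | succ n =>
    rw [exactAt_iff]
    exact ShortComplex.exact_of_isZero_X₂ _ (isZero_twoTermComplex_X S n)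

/-- The projective resolution of length one given by a short exact sequence whose first two
terms are projective. -/
noncomputable def projectiveResolution (hS : S.ShortExact) [Projective S.X₁] [Projective S.X₂] :
    ProjectiveResolution S.X₃ where
  complex := twoTermComplex S
  projective n := by
    match n with
    | 0 => exact Projective.of_iso (doubleXIso₁ _ _ one_ne_zero).symm ‹_›
    | 1 => exact Projective.of_iso (doubleXIso₀ _ _).symm ‹_›
    | n + 2 => exact (isZero_twoTermComplex_X S n).projective
  π := (ChainComplex.toSingle₀Equiv _ _).symm
    ⟨(doubleXIso₁ _ _ one_ne_zero).hom ≫ S.g, twoTermComplex_d_hom_g S⟩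
  quasiIso := ⟨fun n => by
    cases n with
    | zero =>
      rw [ChainComplex.quasiIsoAt₀_iff, ShortComplex.quasiIso_iff_of_zeros']
      · refine (ShortComplex.exact_and_epi_g_iff_of_iso (S₂ := S) ?_).2 ⟨hS.exact, hS.epi_g⟩
        refine ShortComplex.isoMk (doubleXIso₀ S.f (show (ComplexShape.down ℕ).Rel 1 0 from rfl))
          (doubleXIso₁ S.f (show (ComplexShape.down ℕ).Rel 1 0 from rfl) one_ne_zero)
          (Iso.refl _) ?_ ?_
        · exact (twoTermComplex_d_hom S).symm
        · exact (ChainComplex.toSingle₀Equiv_symm_apply_f_zero (C := twoTermComplex S) _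
            (twoTermComplex_d_hom_g S)).symm.trans
            (Category.comp_id _).symm
      · exact (twoTermComplex S).shape 0 0 (by simp)
      all_goals rfl
    | succ n =>
      rw [quasiIsoAt_iff_exactAt']
      · exact hS.twoTermComplex_exactAt_succ n
      · apply ChainComplex.exactAt_succ_single_obj⟩

variable {D : Type*} [Category* D] [Abelian D]

lemma isZero_leftDerived_obj [HasProjectiveResolutions C] (hS : S.ShortExact)
    [Projective S.X₁] [Projective S.X₂] (F : C ⥤ D) [F.Additive] (n : ℕ) :
    IsZero ((F.leftDerived (n + 2)).obj S.X₃) := by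
  refine IsZero.of_iso ?_ (hS.projectiveResolution.isoLeftDerivedObj F (n + 2))
  refine (exactAt_iff_isZero_homology _ _).1 ?_
  rw [exactAt_iff]
  exact ShortComplex.exact_of_isZero_X₂ _ (F.map_isZero (isZero_twoTermComplex_X S n))

lemma isZero_of_isZero_leftDerived_one_obj [HasProjectiveResolutions C] (hS : S.ShortExact)
    [Projective S.X₁] [Projective S.X₂] (F : C ⥤ D) [F.Additive] (hF : F.map S.f = 0)
    (h : IsZero ((F.leftDerived 1).obj S.X₃)) : IsZero (F.obj S.X₁) := by
  have h' := h.of_iso (hS.projectiveResolution.isoLeftDerivedObj F 1).symm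
  have h₁ := (exactAt_iff_isZero_homology _ _).2 h'
  rw [exactAt_iff' _ 2 1 0 (by simp) (by simp)] at h₁
  have h₂ : IsZero (F.obj ((twoTermComplex S).X 1)) := by
    refine h₁.isZero_of_both_zeros ?_ ?_
    · exact (F.map_isZero (isZero_twoTermComplex_X S 0)).eq_of_src _ _
    · change F.map ((twoTermComplex S).d 1 0) = 0
      rw [double_d _ _ one_ne_zero]
      simp [hF]
  exact h₂.of_iso (F.mapIso (doubleXIso₀ S.f _)).symm

lemma isZero_Ext [EnoughProjectives C] {R : Type*} [Ring R] [Linear R C] (hS : S.ShortExact)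
    [Projective S.X₁] [Projective S.X₂] (n : ℕ) (Y : C) :
    IsZero (((Ext R C (n + 2)).obj (Opposite.op S.X₃)).obj Y) := by
  refine IsZero.of_iso ?_ (hS.projectiveResolution.isoExt (n + 2) Y)
  rw [← exactAt_iff_isZero_homology, exactAt_iff]
  refine ShortComplex.exact_of_isZero_X₂ _ ?_
  have := ((linearYoneda R C).obj Y).rightOp.map_isZero (isZero_twoTermComplex_X S n)
  exact this.unop

end CategoryTheory.ShortComplex.ShortExact

open RingTheory.Sequence IsLocalRing Pointwise

section CommutativeAlgebra

variable {A : Type u} [CommRing A] [IsLocalRing A]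

lemma exists_isRegular_quotSMulTop [IsNoetherianRing A]
    {M : Type u} [AddCommGroup M] [Module A M] [Module.Finite A M] [Nontrivial M] {a : A}
    (ha : a ∈ maximalIdeal A) (hreg : IsSMulRegular M a) {n : ℕ}
    (h : ∃ rs : List A, rs.length = n + 1 ∧ (∀ r ∈ rs, r ∈ maximalIdeal A) ∧ IsRegular M rs) :
    ∃ rs : List A, rs.length = n ∧ (∀ r ∈ rs, r ∈ maximalIdeal A) ∧
      IsRegular (QuotSMulTop a M) rs := by
  have smul_lt (N : Type u) [AddCommGroup N] [Module A N] [Module.Finite A N] [Nontrivial N] :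
      maximalIdeal A • (⊤ : Submodule A N) < ⊤ :=
    (Submodule.top_ne_ideal_smul_of_le_jacobson_annihilator
      (maximalIdeal_le_jacobson _)).symm.lt_top
  have := nontrivial_quotSMulTop_of_mem_maximalIdeal M ha
  have hExt := ((ModuleCat.exists_isRegular_tfae (maximalIdeal A) (n + 1) (.of A M)
    (smul_lt M)).out 3 1).1 h
  refine ((ModuleCat.exists_isRegular_tfae (maximalIdeal A) n (.of A (QuotSMulTop a M))
    (smul_lt _)).out 1 3).1 fun i hi ↦ ?_
  have zero₁ := AddCommGrpCat.isZero_of_iff_subsingleton.mpr (hExt i (by lia))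
  have zero₂ := AddCommGrpCat.isZero_of_iff_subsingleton.mpr (hExt (i + 1) (by lia))
  exact AddCommGrpCat.subsingleton_of_isZero <| ShortComplex.Exact.isZero_of_both_zeros
    (Abelian.Ext.covariant_sequence_exact₃' _
      (IsSMulRegular.smulShortComplex_shortExact (M := .of A M) hreg) i (i + 1) rfl)
    (zero₁.eq_zero_of_src _) (zero₂.eq_zero_of_tgt _)

lemma exists_isRegular_quotient_ofList [IsNoetherianRing A]
    {M : Type u} [AddCommGroup M] [Module A M] [Module.Finite A M] {as : List A}
    (has : ∀ a ∈ as, a ∈ maximalIdeal A) (hreg : IsRegular M as) {n : ℕ}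
    (h : ∃ rs : List A, rs.length = n + as.length ∧ (∀ r ∈ rs, r ∈ maximalIdeal A) ∧
      IsRegular M rs) :
    ∃ rs : List A, rs.length = n ∧ (∀ r ∈ rs, r ∈ maximalIdeal A) ∧
      IsRegular (M ⧸ (Ideal.ofList as • ⊤ : Submodule A M)) rs := by
  have := hreg.nontrivial
  induction as generalizing M with
  | nil =>
    obtain ⟨rs, hlen, hmem, hrs⟩ := h
    refine ⟨rs, hlen, hmem, ((Submodule.quotEquivOfEqBot _ ?_).isRegular_congr rs).2 hrs⟩
    simp
  | cons a as ih =>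
    rw [isRegular_cons_iff] at hreg
    simp only [List.mem_cons, forall_eq_or_imp] at has
    have := nontrivial_quotSMulTop_of_mem_maximalIdeal M has.1
    obtain ⟨rs, hlen, hmem, hrs⟩ := ih has.2 hreg.2
      (exists_isRegular_quotSMulTop has.1 hreg.1 h) this
    exact ⟨rs, hlen, hmem,
      ((Submodule.quotOfListConsSMulTopEquivQuotSMulTopInner M a as).isRegular_congr rs).2 hrs⟩

lemma ofList_le_maximalIdeal {rs : List A} (h : IsRegular A rs) :
    Ideal.ofList rs ≤ maximalIdeal A :=
  le_maximalIdeal fun h' ↦ h.top_ne_smul (by simp [h'])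

lemma mem_maximalIdeal_of_isRegular {rs : List A} (h : IsRegular A rs) :
    ∀ r ∈ rs, r ∈ maximalIdeal A :=
  fun _ hr ↦ ofList_le_maximalIdeal h (Ideal.subset_span hr)

lemma ringKrullDim_le_of_faithfullyFlat (A B : Type*) [CommRing A] [CommRing B] [Algebra A B]
    [Module.FaithfullyFlat A B] : ringKrullDim A ≤ ringKrullDim B := by
  refine iSup_le fun l ↦ ?_
  obtain ⟨P, hP⟩ := PrimeSpectrum.comap_surjective_of_faithfullyFlat (B := B) l.last
  have : P.asIdeal.LiesOver l.last.asIdeal := ⟨by rw [← hP]; rfl⟩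
  obtain ⟨L, hL, -⟩ := Ideal.exists_ltSeries_of_hasGoingDown l P.asIdeal
  rw [← hL]
  exact le_iSup (fun p : LTSeries (PrimeSpectrum B) ↦ ((p.length : ℕ∞) : WithBot ℕ∞)) L

lemma length_le_supportDim [IsNoetherianRing A] {M : Type*} [AddCommGroup M] [Module A M]
    [Module.Finite A M] {rs : List A} (h : IsRegular M rs) :
    (rs.length : WithBot ℕ∞) ≤ Module.supportDim A M := by
  have := h.quot_ofList_smul_nontrivial
  rw [← Module.supportDim_add_length_eq_supportDim_of_isRegular rs h]
  exact le_add_of_nonneg_left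
    (Order.krullDim_nonneg_iff.2 Module.nonempty_support_of_nontrivial.to_subtype)

lemma exists_isRegular_length_eq_ringKrullDim {Q : Type u} [CommRing Q] [IsLocalRing Q]
    (hQ : IsRegularLocal Q) :
    ∃ rs : List Q, IsRegular Q rs ∧ ringKrullDim Q = rs.length := by
  obtain ⟨-, _, rs, hrs, hmax⟩ := hQ
  refine ⟨rs, hrs, ?_⟩
  rw [← ringKrullDim_add_length_eq_ringKrullDim_of_isRegular rs hrs]
  have : Ideal.IsMaximal (Ideal.ofList rs) := hmax
  let := Ideal.Quotient.field (Ideal.ofList rs)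
  simp [ringKrullDim_eq_zero_of_field]

lemma exists_isSMulRegular_quotient_span_singleton {Q B : Type u} [CommRing Q] [CommRing B]
    [IsLocalRing B] (hQ : IsRegularLocal Q) {φ : Q →+* B} (hφ : Function.Surjective φ)
    {rs : List Q} (hrs : IsRegular Q rs) (hker : RingHom.ker φ = Ideal.ofList rs)
    (hdim : 2 ≤ ringKrullDim B) {b : B} (hb : b ∈ maximalIdeal B) (hreg : IsSMulRegular B b) :
    ∃ r ∈ maximalIdeal B, IsSMulRegular (B ⧸ Ideal.span {b}) r := by
  have := hQ.1
  have := hQ.2.1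
  obtain ⟨gs, hgs, hlen⟩ := exists_isRegular_length_eq_ringKrullDim hQ
  obtain ⟨t, rfl⟩ := hφ b
  have ht : t ∈ maximalIdeal Q := fun h ↦ hb (h.map φ)
  have hmem : ∀ r ∈ rs ++ [t], r ∈ maximalIdeal Q := by
    simpa [or_imp, forall_and] using ⟨mem_maximalIdeal_of_isRegular hrs, ht⟩
  have hrst : IsRegular Q (rs ++ [t]) := by
    refine IsRegular.of_isWeaklyRegular_of_mem_maximalIdeal Q hmem ?_
    rw [isWeaklyRegular_append_iff, isWeaklyRegular_singleton_iff]
    refine ⟨hrs.1, (isSMulRegular_quotient_iff_mem_of_smul_mem _ _).2 fun u hu ↦ ?_⟩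
    simp only [smul_eq_mul, Ideal.mul_top, ← hker, RingHom.mem_ker, map_mul] at hu ⊢
    exact hreg (by simpa using hu)
  have hle : 2 + rs.length ≤ gs.length := by
    rw [← ringKrullDim_eq_of_ringEquiv (RingHom.quotientKerEquivOfSurjective hφ), hker] at hdim
    have := add_le_add_left hdim (rs.length : WithBot ℕ∞)
    rw [ringKrullDim_add_length_eq_ringKrullDim_of_isRegular rs hrs, hlen] at this
    exact_mod_cast this
  obtain ⟨ss, hss, hssmem, hssreg⟩ := exists_isRegular_quotient_ofList
    (n := gs.length - rs.length - 1) hmem hrst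
    ⟨gs, by simp; lia, mem_maximalIdeal_of_isRegular hgs, hgs⟩
  obtain _ | ⟨s, ss⟩ := ss
  · simp at hss
    lia
  have := IsLocalHom.of_surjective φ hφ
  refine ⟨φ s, map_mem_nonunits_iff φ s |>.2 (hssmem s (by simp)), ?_⟩
  · have hs := ((isRegular_cons_iff _ _ _).1 hssreg).1
    rw [isSMulRegular_quotient_iff_mem_of_smul_mem] at hs ⊢
    intro v hv
    obtain ⟨u, rfl⟩ := hφ v
    have hmap : (Ideal.ofList (rs ++ [t])).map φ = Ideal.span {φ t} := by
      rw [Ideal.ofList_append, Ideal.map_sup, ← hker, Ideal.ofList_singleton, Ideal.map_span,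
        Set.image_singleton, (Ideal.map_eq_bot_iff_le_ker φ).2 le_rfl, bot_sup_eq]
    have hcomap : (Ideal.span {φ t}).comap φ = Ideal.ofList (rs ++ [t]) := by
      rw [← hmap, Ideal.comap_map_of_surjective' φ hφ, sup_eq_left, hker, Ideal.ofList_append]
      exact le_sup_left
    simp only [smul_eq_mul, Ideal.mul_top, ← hcomap, Ideal.mem_comap, map_mul] at hs
    exact hs u hv

lemma exists_isSMulRegular_quotient_of_faithfullyFlat [IsNoetherianRing A] {B : Type*}
    [CommRing B] [IsLocalRing B] [Algebra A B] [Module.FaithfullyFlat A B]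
    (hmax : (maximalIdeal A).map (algebraMap A B) = maximalIdeal B) {I : Ideal A}
    (h : ∃ r ∈ maximalIdeal B, IsSMulRegular (B ⧸ I.map (algebraMap A B)) r) :
    ∃ r ∈ maximalIdeal A, IsSMulRegular (A ⧸ I) r := by
  obtain ⟨r, hr, hreg⟩ := h
  have := (IsSMulRegular.subsingleton_linearMap_iff (R := A) (N := A ⧸ maximalIdeal A)
    (M := A ⧸ I)).1 ⟨?_⟩
  · simpa [Ideal.annihilator_quotient] using this
  suffices h : ∀ f : (A ⧸ maximalIdeal A) →ₗ[A] (A ⧸ I), f = 0 from fun f g ↦ by rw [h f, h g]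
  intro f
  obtain ⟨z, hz⟩ := Ideal.Quotient.mk_surjective (f 1)
  suffices hzI : z ∈ I by
    refine LinearMap.ext fun a ↦ ?_
    obtain ⟨a, rfl⟩ := Ideal.Quotient.mk_surjective a
    have : Ideal.Quotient.mk (maximalIdeal A) a = a • 1 := by
      rw [Algebra.smul_def, mul_one]; rfl
    rw [this, map_smul, ← hz, Ideal.Quotient.eq_zero_iff_mem.2 hzI, smul_zero,
      LinearMap.zero_apply]
  rw [← Ideal.comap_map_eq_self_of_faithfullyFlat (B := B) I, Ideal.mem_comap]
  rw [isSMulRegular_quotient_iff_mem_of_smul_mem] at hreg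
  refine hreg _ ?_
  rw [← hmax] at hr
  refine Submodule.span_induction
    (p := fun r _ ↦ r • algebraMap A B z ∈ I.map (algebraMap A B)) ?_ ?_ ?_ ?_ hr
  · rintro _ ⟨a, ha, rfl⟩
    rw [smul_eq_mul, ← map_mul]
    refine Ideal.mem_map_of_mem _ (Ideal.Quotient.eq_zero_iff_mem.1 ?_)
    have : a • (1 : A ⧸ maximalIdeal A) = 0 := by
      rw [Algebra.smul_def, mul_one]; exact Ideal.Quotient.eq_zero_iff_mem.2 ha
    calc Ideal.Quotient.mk I (a * z) = a • Ideal.Quotient.mk I z := by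
          rw [map_mul, Algebra.smul_def]; rfl
      _ = 0 := by rw [hz, ← map_smul, this, map_zero]
  · simp
  · intro a b _ _ ha hb
    rw [add_smul]
    exact add_mem ha hb
  · intro a b _ hb
    rw [smul_assoc]
    exact Ideal.mul_mem_left _ _ hb

lemma exists_isSMulRegular_quotient_of_isCompleteIntersectionLocal {A : Type u} [CommRing A]
    [IsLocalRing A] [IsNoetherianRing A] (hA : IsCompleteIntersectionLocal A)
    (hdim : 2 ≤ ringKrullDim A) {x : A} (hx : x ∈ maximalIdeal A) (hreg : IsSMulRegular A x) :
    ∃ y ∈ maximalIdeal A, IsSMulRegular (A ⧸ Ideal.span {x}) y := by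
  obtain ⟨Q, φ, hQ, hφ, rs, hrs, hker⟩ := hA
  have : Module.Flat A (AdicCompletion (maximalIdeal A) A) := AdicCompletion.flat_of_isNoetherian _
  have : Module.FaithfullyFlat A (AdicCompletion (maximalIdeal A) A) :=
    Module.FaithfullyFlat.of_flat_of_isLocalHom
  have hmax : (maximalIdeal A).map (algebraMap A (AdicCompletion (maximalIdeal A) A)) = _ :=
    (AdicCompletion.maximalIdeal_eq_map).symm
  refine exists_isSMulRegular_quotient_of_faithfullyFlat
    (B := AdicCompletion (maximalIdeal A) A) hmax ?_
  rw [Ideal.map_span, Set.image_singleton]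
  refine exists_isSMulRegular_quotient_span_singleton hQ hφ hrs hker
    (hdim.trans (ringKrullDim_le_of_faithfullyFlat _ _)) ?_ ?_
  · rw [← hmax]
    exact Ideal.mem_map_of_mem _ hx
  · exact hreg.of_flat

end CommutativeAlgebra

section Depth

variable {A : Type u} [CommRing A] [IsLocalRing A]

lemma depth_congr {M N : ModuleCat.{u} A} (e : M ≃ₗ[A] N) : depth A M = depth A N := by
  simp only [depth, e.isRegular_congr]

lemma depth_le_of_supportDim_le [IsNoetherianRing A] {M : ModuleCat.{u} A} [Module.Finite A M]
    {k : ℕ} (h : Module.supportDim A M ≤ k) : depth A M ≤ k := by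
  refine csSup_le' ?_
  rintro _ ⟨rs, rfl, -, hrs⟩
  exact_mod_cast (length_le_supportDim hrs).trans h

lemma length_le_depth_of_supportDim_le [IsNoetherianRing A] {M : ModuleCat.{u} A}
    [Module.Finite A M] {k : ℕ} (h : Module.supportDim A M ≤ k) {rs : List A}
    (hmem : ∀ r ∈ rs, r ∈ maximalIdeal A) (hrs : IsRegular M rs) : rs.length ≤ depth A M := by
  refine le_csSup ⟨k, ?_⟩ ⟨rs, rfl, hmem, hrs⟩
  rintro _ ⟨rs, rfl, -, hrs⟩
  exact_mod_cast (length_le_supportDim hrs).trans h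

lemma depth_quotient_span_singleton_eq_one [IsNoetherianRing A]
    (hA : IsCompleteIntersectionLocal A) (hdim : ringKrullDim A = 2) {x : A}
    (hx : x ∈ maximalIdeal A) (hreg : x ∈ nonZeroDivisors A) :
    depth A (ModuleCat.of A (A ⧸ Ideal.span {x})) = 1 := by
  have : Nontrivial (A ⧸ Ideal.span {x}) := Ideal.Quotient.nontrivial_iff.2
    (ne_top_of_le_ne_top Ideal.IsPrime.ne_top' ((Ideal.span_singleton_le_iff_mem _).2 hx))
  have hle : Module.supportDim A (A ⧸ Ideal.span {x}) ≤ (1 : ℕ) := by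
    rw [Module.supportDim_quotient_eq_ringKrullDim, ← ENat.WithBot.add_le_add_natCast_right_iff
      (c := 1), Nat.cast_one,
      ringKrullDim_quotient_span_singleton_succ_eq_ringKrullDim_of_mem_nonZeroDivisors hreg hx,
      hdim]
    norm_num
  refine le_antisymm (depth_le_of_supportDim_le hle) ?_
  obtain ⟨y, hy, hyreg⟩ := exists_isSMulRegular_quotient_of_isCompleteIntersectionLocal hA hdim.ge
    hx (Module.Flat.isSMulRegular_of_nonZeroDivisors hreg)
  exact length_le_depth_of_supportDim_le hle (rs := [y]) (by simpa using hy)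
    (IsRegular.of_isWeaklyRegular_of_mem_maximalIdeal _ (by simpa using hy)
      ((isWeaklyRegular_singleton_iff _ _).2 hyreg))

end Depth

section Tor

variable {A : Type u} [CommRing A]

/-- The complex `A → A → A ⧸ (x)` whose first map is multiplication by `x`. -/
def mulQuotientShortComplex (x : A) : ShortComplex (ModuleCat.{u} A) where
  f := ModuleCat.ofHom (LinearMap.lsmul A A x)
  g := ModuleCat.ofHom (Ideal.span {x}).mkQ
  zero := by
    ext
    simp

lemma mulQuotientShortComplex_shortExact {x : A} (hx : x ∈ nonZeroDivisors A) :
    (mulQuotientShortComplex x).ShortExact := by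
  have hreg : IsSMulRegular A x := Module.Flat.isSMulRegular_of_nonZeroDivisors hx
  refine ModuleCat.shortComplex_shortExact _ (fun a ↦ ?_) hreg (Submodule.mkQ_surjective _)
  refine Ideal.Quotient.eq_zero_iff_mem.trans (Ideal.mem_span_singleton.trans ?_)
  exact exists_congr fun _ ↦ eq_comm

instance (x : A) : Projective (mulQuotientShortComplex x).X₁ :=
  inferInstanceAs (Projective (ModuleCat.of A A))

instance (x : A) : Projective (mulQuotientShortComplex x).X₂ :=
  inferInstanceAs (Projective (ModuleCat.of A A))

lemma subsingleton_TorMod {x : A} (hx : x ∈ nonZeroDivisors A) (N : ModuleCat.{u} A) (n : ℕ) :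
    Subsingleton (TorMod A (n + 2) (ModuleCat.of A (A ⧸ Ideal.span {x})) N) :=
  ModuleCat.subsingleton_of_isZero ((mulQuotientShortComplex_shortExact hx).isZero_leftDerived_obj
    ((MonoidalCategory.tensoringRight _).obj N) n)

lemma not_subsingleton_TorMod_one {x : A} (hx : x ∈ nonZeroDivisors A) {N : ModuleCat.{u} A}
    [Nontrivial N] (hN : x ∈ Module.annihilator A N) :
    ¬ Subsingleton (TorMod A 1 (ModuleCat.of A (A ⧸ Ideal.span {x})) N) := by
  intro h
  have hzero := (mulQuotientShortComplex_shortExact hx).isZero_of_isZero_leftDerived_one_obj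
    ((MonoidalCategory.tensoringRight _).obj N) ?_ (ModuleCat.isZero_iff_subsingleton.2 h)
  · have := ModuleCat.subsingleton_of_isZero (hzero.of_iso (MonoidalCategory.leftUnitor N).symm)
    exact not_subsingleton N this
  · refine ModuleCat.hom_ext (TensorProduct.ext' fun a n ↦ ?_)
    change (x • a) ⊗ₜ[A] n = 0
    rw [TensorProduct.smul_tmul, Module.mem_annihilator.1 hN, TensorProduct.tmul_zero]

lemma subsingleton_ExtMod {x : A} (hx : x ∈ nonZeroDivisors A) (N : ModuleCat.{u} A) (n : ℕ) :
    Subsingleton (ExtMod A (n + 2) (ModuleCat.of A (A ⧸ Ideal.span {x})) N) :=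
  ModuleCat.subsingleton_of_isZero ((mulQuotientShortComplex_shortExact hx).isZero_Ext n N)

lemma numGen_eq_zero_of_subsingleton (M : ModuleCat.{u} A) [Subsingleton M] : numGen A M = 0 :=
  Nat.sInf_eq_zero.2 (.inl ⟨∅, rfl, Subsingleton.elim _ _⟩)

lemma seqComplexity_eq_zero {b : ℕ → ℕ} (h : ∀ᶠ n in Filter.atTop, b n = 0) :
    seqComplexity b = 0 :=
  Nat.sInf_eq_zero.2 (.inl ⟨0, h.mono fun n hn ↦ by simp [hn]⟩)

lemma cx_quotient_span_singleton_eq_zero {x : A} (hx : x ∈ nonZeroDivisors A)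
    (N : ModuleCat.{u} A) : cx A (ModuleCat.of A (A ⧸ Ideal.span {x})) N = 0 := by
  refine seqComplexity_eq_zero (Filter.eventually_atTop.2 ⟨2, fun n hn ↦ ?_⟩)
  obtain ⟨n, rfl⟩ := Nat.exists_eq_add_of_le' hn
  have := subsingleton_ExtMod hx N n
  exact numGen_eq_zero_of_subsingleton _

end Tor

open scoped TensorProduct in
theorem stmt19 (R : Type u) [CommRing R] [IsLocalRing R] [IsNoetherianRing R]
    (hci : IsCompleteIntersectionLocal R) (hdim : ringKrullDim R = 2)
    (x : R) (hx : x ∈ IsLocalRing.maximalIdeal R) (hreg : x ∈ nonZeroDivisors R) :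
    letI X : ModuleCat.{u} R := ModuleCat.of R (R ⧸ Ideal.span {x})
    letI C : ModuleCat.{u} R :=
      ModuleCat.of R (R ⧸ Submodule.annihilator (⊤ : Submodule R (R ⧸ Ideal.span {x})))
    ¬ Subsingleton (TorMod R 1 X C) ∧
    (∀ i : ℕ, 2 ≤ i → Subsingleton (TorMod R i X C)) ∧
    cx R X C = 0 ∧
    depth R (ModuleCat.of R (↥X ⊗[R] ↥C)) = 1 ∧
    depth R (ModuleCat.of R (↥X ⊗[R] ↥C)) = cx R X C + 1 ∧
    depth R (ModuleCat.of R R) + cx R X C ≤ depth R X + depth R C := by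
  rw [Submodule.annihilator_top, Ideal.annihilator_quotient]
  have : Nontrivial (R ⧸ Ideal.span {x}) := Ideal.Quotient.nontrivial_iff.2
    (ne_top_of_le_ne_top Ideal.IsPrime.ne_top' ((Ideal.span_singleton_le_iff_mem _).2 hx))
  have hdepth := depth_quotient_span_singleton_eq_one hci hdim hx hreg
  have hcx := cx_quotient_span_singleton_eq_zero hreg (ModuleCat.of R (R ⧸ Ideal.span {x}))
  have htensor : depth R (ModuleCat.of R ((R ⧸ Ideal.span {x}) ⊗[R] (R ⧸ Ideal.span {x}))) = 1 := by
    rw [← hdepth]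
    refine depth_congr ((TensorProduct.quotTensorEquivQuotSMul _ _).trans
      (Submodule.quotEquivOfEqBot _ ?_))
    simp
  have hdepthR : depth R (ModuleCat.of R R) ≤ 2 :=
    depth_le_of_supportDim_le ((Module.supportDim_self_eq_ringKrullDim R).trans_le hdim.le)
  refine ⟨not_subsingleton_TorMod_one hreg ?_, fun i hi ↦ ?_, hcx, htensor, ?_, ?_⟩
  · rw [Ideal.annihilator_quotient]
    exact Ideal.mem_span_singleton_self x
  · obtain ⟨n, rfl⟩ := Nat.exists_eq_add_of_le' hi
    exact subsingleton_TorMod hreg _ n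
  · rw [htensor, hcx]
  · rw [hcx, hdepth]
    exact hdepthR
end
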